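/- Let d_e ≤ d be positive integers, set n = d − d_e + 1, and let z ∈ ℝ^{d_e} be a fixed nonzero vector. For a d_e×d matrix B define y₂(B) = Bᵀ (B Bᵀ)⁻¹ z (defined for the almost-every B for which B Bᵀ is invertible, with an arbitrary value otherwise). Then the pushforward of the Gaussian matrix measure under B ↦ y₂(B) is absolutely continuous with respect to Lebesgue measure on ℝ^d with density g(y) = π^{−d/2} · (Γ(d/2)/Γ(n/2)) · (‖z‖₂/√2)^n · (yᵀy)^{−(n+d)/2} · exp(−‖z‖₂²/(2 yᵀy)) for y ≠ 0. -/

import Mathlib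

open MeasureTheory ProbabilityTheory Matrix

noncomputable def gaussMatrix (D d : ℕ) : Measure (Fin D → Fin d → ℝ) :=
  Measure.pi fun _ : Fin D => Measure.pi fun _ : Fin d => gaussianReal 0 1

noncomputable def chiSq (n : ℕ) : Measure ℝ := gammaMeasure (n / 2) (1 / 2)

/-- Two vectors of equal norm are related by a linear isometry. -/
lemma exists_linearIsometryEquiv_apply_eq {E : Type*} [NormedAddCommGroup E] [InnerProductSpace ℝ E]
    {v w : E} (h : ‖v‖ = ‖w‖) :
    ∃ f : E ≃ₗᵢ[ℝ] E, f v = w :=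
  ⟨_, Submodule.reflection_sub h⟩

section Radial

variable {E : Type*} [NormedAddCommGroup E] [InnerProductSpace ℝ E] [FiniteDimensional ℝ E]
  [MeasurableSpace E] [BorelSpace E]

lemma charFun_eq_of_norm_eq {μ : Measure E} (hμ : ∀ f : E ≃ₗᵢ[ℝ] E, μ.map f = μ)
    {v w : E} (h : ‖v‖ = ‖w‖) : charFun μ v = charFun μ w := by
  obtain ⟨f, rfl⟩ := exists_linearIsometryEquiv_apply_eq h.symm
  conv_lhs => rw [← hμ f]
  rw [charFun_apply, charFun_apply, integral_map (by fun_prop) (by fun_prop)]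
  simp

/-- The standard Gaussian measure has the usual density. -/
lemma stdGaussian_eq_withDensity :
    stdGaussian E = volume.withDensity (fun x : E => ENNReal.ofReal
      ((2 * Real.pi) ^ (-(Module.finrank ℝ E : ℝ) / 2) * Real.exp (-‖x‖ ^ 2 / 2))) := by
  have hint : Integrable (fun x : E => Real.exp (-‖x‖ ^ 2 / 2)) := by
    have := (GaussianFourier.integrable_cexp_neg_mul_sq_norm_add (V := E) (b := 1 / 2)
      (by norm_num) 0 0).re
    refine this.congr (.of_forall fun x => ?_)
    simp only [zero_mul, add_zero]
    rw [show -(1 / 2 : ℂ) * (‖x‖ : ℂ) ^ 2 = ((-‖x‖ ^ 2 / 2 : ℝ) : ℂ) by push_cast; ring]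
    exact Complex.exp_ofReal_re _
  have hfin : IsFiniteMeasure (volume.withDensity (fun x : E => ENNReal.ofReal
      ((2 * Real.pi) ^ (-(Module.finrank ℝ E : ℝ) / 2) * Real.exp (-‖x‖ ^ 2 / 2)))) :=
    isFiniteMeasure_withDensity_ofReal (hint.const_mul _).2
  apply Measure.ext_of_charFun
  ext t
  rw [charFun_stdGaussian, charFun_apply, integral_withDensity_eq_integral_toReal_smul
    (by fun_prop) (by simp)]
  have key := GaussianFourier.integral_cexp_neg_mul_sq_norm_add (V := E) (b := 1 / 2)
      (by norm_num) Complex.I t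
  have hpi : (Real.pi / (1 / 2) : ℂ) = ((2 * Real.pi : ℝ) : ℂ) := by push_cast; ring
  have hpow : ((Real.pi / (1 / 2) : ℂ) ^ (Module.finrank ℝ E / 2 : ℂ)) =
      (((2 * Real.pi) ^ ((Module.finrank ℝ E : ℝ) / 2) : ℝ) : ℂ) := by
    rw [hpi, Complex.ofReal_cpow (by positivity)]; push_cast; rfl
  have : ∀ x : E, (ENNReal.ofReal ((2 * Real.pi) ^ (-(Module.finrank ℝ E : ℝ) / 2) *
      Real.exp (-‖x‖ ^ 2 / 2))).toReal • Complex.exp (inner ℝ x t * Complex.I) =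
      (((2 * Real.pi) ^ (-(Module.finrank ℝ E : ℝ) / 2) : ℝ) : ℂ) *
        Complex.exp (-(1 / 2) * ‖x‖ ^ 2 + Complex.I * inner ℝ t x) := by
    intro x
    rw [ENNReal.toReal_ofReal (by positivity), Complex.exp_add, Complex.real_smul,
      Complex.ofReal_mul, Complex.ofReal_exp, real_inner_comm, mul_comm Complex.I]
    push_cast
    ring_nf
  simp_rw [this]
  rw [integral_const_mul, key, hpow, ← mul_assoc, ← Complex.ofReal_mul,
    ← Real.rpow_add (by positivity)]
  simp only [Complex.I_sq]
  ring_nf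
  simp

lemma stdGaussian_absolutelyContinuous : stdGaussian E ≪ volume := by
  rw [stdGaussian_eq_withDensity]
  exact withDensity_absolutelyContinuous _ _

lemma ae_stdGaussian_notMem {s : Submodule ℝ E} (hs : s ≠ ⊤) : ∀ᵐ x ∂(stdGaussian E), x ∉ s :=
  stdGaussian_absolutelyContinuous.ae_le
    (measure_eq_zero_iff_ae_notMem.mp (Measure.addHaar_submodule volume s hs))

/-- The characteristic function of a rotation invariant measure is an average over its radial
law. -/
lemma charFun_eq_integral_map_norm [Nontrivial E] {μ : Measure E} [IsFiniteMeasure μ]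
    (hμ : ∀ f : E ≃ₗᵢ[ℝ] E, μ.map f = μ) {e : E} (he : ‖e‖ = 1) (t : E) :
    charFun μ t = ∫ r, ∫ g, Complex.exp ((‖t‖ / ‖g‖ * r * inner ℝ e g : ℝ) * Complex.I)
      ∂(stdGaussian E) ∂(μ.map norm) := by
  have h0 : ∀ᵐ g ∂(stdGaussian E), g ∉ (⊥ : Submodule ℝ E) := ae_stdGaussian_notMem bot_ne_top
  have h1 : charFun μ t = ∫ g, charFun μ ((‖t‖ / ‖g‖) • g) ∂(stdGaussian E) := by
    have : ∀ᵐ g ∂(stdGaussian E), charFun μ ((‖t‖ / ‖g‖) • g) = charFun μ t := by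
      filter_upwards [h0] with g hg
      refine charFun_eq_of_norm_eq hμ ?_
      have : ‖g‖ ≠ 0 := by simpa using hg
      rw [norm_smul, norm_div, norm_norm, norm_norm, div_mul_cancel₀ _ this]
    rw [integral_congr_ae this]
    simp
  rw [h1]
  simp_rw [charFun_apply]
  have hbd : ∀ {α : Type _} [MeasurableSpace α] (m : Measure α) [IsFiniteMeasure m] (f : α → ℝ),
      Measurable f → Integrable (fun a => Complex.exp (f a * Complex.I)) m := by
    intro α _ m _ f hf
    refine (integrable_const (1 : ℝ)).mono' (by fun_prop) (.of_forall fun a => ?_)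
    rw [Complex.norm_exp_ofReal_mul_I]
  rw [integral_integral_swap]
  · rw [integral_map (by fun_prop)]
    · refine integral_congr_ae (.of_forall fun y => ?_)
      dsimp only
      obtain ⟨f, hf⟩ := exists_linearIsometryEquiv_apply_eq (v := ‖y‖ • e) (w := y)
        (by simp [norm_smul, he])
      conv_lhs => rw [← stdGaussian_map f]
      rw [integral_map (by fun_prop) (by fun_prop)]
      refine integral_congr_ae (.of_forall fun g => ?_)
      dsimp only
      rw [LinearIsometryEquiv.norm_map, ← map_smul]
      conv_lhs => rw [← hf, LinearIsometryEquiv.inner_map_map, real_inner_smul_left,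
        real_inner_smul_right]
      congr 3
      ring
    · refine (StronglyMeasurable.integral_prod_right (f := fun r g => Complex.exp
        ((‖t‖ / ‖g‖ * r * inner ℝ e g : ℝ) * Complex.I)) ?_).aestronglyMeasurable
      exact Measurable.stronglyMeasurable (by fun_prop)
  · exact hbd ((stdGaussian E).prod μ) (fun p => inner ℝ p.2 ((‖t‖ / ‖p.1‖) • p.1)) (by fun_prop)

/-- A finite rotation invariant measure is determined by the law of the norm. -/
lemma ext_of_map_norm_eq [Nontrivial E] {μ ν : Measure E} [IsFiniteMeasure μ] [IsFiniteMeasure ν]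
    (hμ : ∀ f : E ≃ₗᵢ[ℝ] E, μ.map f = μ) (hν : ∀ f : E ≃ₗᵢ[ℝ] E, ν.map f = ν)
    (h : μ.map norm = ν.map norm) : μ = ν := by
  obtain ⟨e, he⟩ := exists_norm_eq E zero_le_one
  apply Measure.ext_of_charFun
  ext t
  rw [charFun_eq_integral_map_norm hμ he, charFun_eq_integral_map_norm hν he, h]

lemma map_withDensity_norm_linearIsometryEquiv {φ : ℝ → ENNReal} (hφ : Measurable φ)
    (f : E ≃ₗᵢ[ℝ] E) :
    (volume.withDensity fun x : E => φ ‖x‖).map f = volume.withDensity fun x : E => φ ‖x‖ := by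
  ext s hs
  rw [Measure.map_apply (by fun_prop) hs, withDensity_apply _ (f.continuous.measurable hs),
    withDensity_apply _ hs,
    ← f.measurePreserving.setLIntegral_comp_preimage hs (by fun_prop)]
  simp

/-- Integration of a radial function in polar coordinates. -/
lemma lintegral_comp_norm [Nontrivial E] {φ : ℝ → ENNReal} (hφ : Measurable φ) :
    ∫⁻ x : E, φ ‖x‖ = Module.finrank ℝ E * volume (Metric.ball (0 : E) 1) *
      ∫⁻ r in Set.Ioi (0 : ℝ), ENNReal.ofReal (r ^ (Module.finrank ℝ E - 1)) * φ r := by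
  calc
    ∫⁻ x : E, φ ‖x‖ = ∫⁻ x : ({(0 : E)}ᶜ : Set E), φ ‖x.1‖ ∂(volume.comap Subtype.val) := by
      rw [lintegral_subtype_comap (measurableSet_singleton _).compl fun x : E => φ ‖x‖,
        restrict_compl_singleton]
    _ = ∫⁻ x, φ x.2 ∂((volume : Measure E).toSphere.prod
          (.volumeIoiPow (Module.finrank ℝ E - 1))) := by
      simpa using (volume : Measure E).measurePreserving_homeomorphUnitSphereProd.lintegral_comp
        (f := φ ∘ Subtype.val ∘ Prod.snd) (by fun_prop)
    _ = (volume : Measure E).toSphere Set.univ *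
          ∫⁻ x : Set.Ioi (0 : ℝ), φ x.1 ∂(Measure.volumeIoiPow (Module.finrank ℝ E - 1)) := by
      rw [lintegral_prod _ (by fun_prop)]
      simp [mul_comm]
    _ = _ := by
      rw [Measure.toSphere_apply_univ, Measure.volumeIoiPow,
        lintegral_withDensity_eq_lintegral_mul _ (by fun_prop) (by fun_prop)]
      congr 1
      exact lintegral_subtype_comap measurableSet_Ioi
        fun r : ℝ => ENNReal.ofReal (r ^ (Module.finrank ℝ E - 1)) * φ r

end Radial

section RadialDensity

/-- The surface area of the unit sphere of a Euclidean space. -/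
lemma finrank_mul_volume_ball {d : ℕ} (hd : 0 < d) :
    (Module.finrank ℝ (EuclideanSpace ℝ (Fin d)) : ENNReal) *
      volume (Metric.ball (0 : EuclideanSpace ℝ (Fin d)) 1) =
        ENNReal.ofReal (2 * Real.pi ^ ((d : ℝ) / 2) / Real.Gamma ((d : ℝ) / 2)) := by
  have : Nonempty (Fin d) := ⟨⟨0, hd⟩⟩
  have hd' : (0 : ℝ) < d := by exact_mod_cast hd
  rw [EuclideanSpace.volume_ball, finrank_euclideanSpace, Fintype.card_fin, ENNReal.ofReal_one,
    one_pow, one_mul, ← ENNReal.ofReal_natCast, ← ENNReal.ofReal_mul (by positivity)]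
  congr 1
  have hG : Real.Gamma ((d : ℝ) / 2) ≠ 0 := (Real.Gamma_pos_of_pos (by positivity)).ne'
  have hpi : √Real.pi ^ d = Real.pi ^ ((d : ℝ) / 2) := by
    rw [Real.sqrt_eq_rpow, ← Real.rpow_natCast, ← Real.rpow_mul Real.pi_pos.le]
    ring_nf
  rw [Real.Gamma_add_one (by positivity), hpi]
  field_simp

/-- The density of the claimed law as a function of the norm of the point. -/
noncomputable def radialDensity (d n : ℕ) (s r : ℝ) : ℝ :=
  Real.pi ^ (-(d : ℝ) / 2) * (Real.Gamma ((d : ℝ) / 2) / Real.Gamma ((n : ℝ) / 2)) *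
    (s / √2) ^ n * (r ^ 2) ^ (-(((n : ℝ) + (d : ℝ)) / 2)) * Real.exp (-s ^ 2 / (2 * r ^ 2))

lemma measurable_radialDensity (d n : ℕ) (s : ℝ) : Measurable (radialDensity d n s) := by
  unfold radialDensity
  fun_prop

lemma sphere_mul_radialDensity {d n : ℕ} (hd : 0 < d) (hn : 0 < n) {s r : ℝ} (hs : 0 < s)
    (hr : 0 < r) :
    2 * Real.pi ^ ((d : ℝ) / 2) / Real.Gamma ((d : ℝ) / 2) *
        (r ^ (d - 1) * radialDensity d n s r) =
      2 * Real.pi ^ ((n : ℝ) / 2) / Real.Gamma ((n : ℝ) / 2) * (s / r ^ 2 * ((s / r) ^ (n - 1) *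
        ((2 * Real.pi) ^ (-(n : ℝ) / 2) * Real.exp (-(s / r) ^ 2 / 2)))) := by
  have hd' : (0 : ℝ) < d := by exact_mod_cast hd
  have hn' : (0 : ℝ) < n := by exact_mod_cast hn
  have hGd : Real.Gamma ((d : ℝ) / 2) ≠ 0 := (Real.Gamma_pos_of_pos (by positivity)).ne'
  have hGn : Real.Gamma ((n : ℝ) / 2) ≠ 0 := (Real.Gamma_pos_of_pos (by positivity)).ne'
  have hexp : -s ^ 2 / (2 * r ^ 2) = -(s / r) ^ 2 / 2 := by field_simp
  have h2 : (s / √2) ^ n = s ^ n * (2 : ℝ) ^ (-(n : ℝ) / 2) := by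
    rw [div_pow, Real.sqrt_eq_rpow, ← Real.rpow_natCast (2 ^ (1 / 2 : ℝ)), ← Real.rpow_mul
      zero_le_two, div_eq_mul_inv, ← Real.rpow_neg zero_le_two]
    ring_nf
  have hrp : (r ^ 2) ^ (-(((n : ℝ) + (d : ℝ)) / 2)) = (r ^ (n + d))⁻¹ := by
    rw [← Real.rpow_natCast r 2, ← Real.rpow_mul hr.le, ← Real.rpow_natCast, ← Real.rpow_neg hr.le]
    push_cast
    ring_nf
  have hpid : Real.pi ^ (-(d : ℝ) / 2) = (Real.pi ^ ((d : ℝ) / 2))⁻¹ := by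
    rw [neg_div, Real.rpow_neg Real.pi_pos.le]
  have hpin : (2 * Real.pi) ^ (-(n : ℝ) / 2) =
      (2 : ℝ) ^ (-(n : ℝ) / 2) * (Real.pi ^ ((n : ℝ) / 2))⁻¹ := by
    rw [Real.mul_rpow zero_le_two Real.pi_pos.le, neg_div, Real.rpow_neg Real.pi_pos.le]
  rw [radialDensity, hexp, h2, hrp, hpid, hpin]
  obtain ⟨d, rfl⟩ := Nat.exists_eq_add_of_lt hd
  obtain ⟨n, rfl⟩ := Nat.exists_eq_add_of_lt hn
  simp only [zero_add, Nat.add_sub_cancel] at *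
  generalize Real.exp _ = e
  have hpi1 : Real.pi ^ (((d + 1 : ℕ) : ℝ) / 2) ≠ 0 := by positivity
  have hpi2 : Real.pi ^ (((n + 1 : ℕ) : ℝ) / 2) ≠ 0 := by positivity
  generalize Real.pi ^ (((d + 1 : ℕ) : ℝ) / 2) = p at *
  generalize Real.pi ^ (((n + 1 : ℕ) : ℝ) / 2) = q at *
  generalize (2 : ℝ) ^ (-((n + 1 : ℕ) : ℝ) / 2) = w at *
  generalize Real.Gamma _ = G at *
  generalize Real.Gamma _ = G' at *
  rw [div_pow]
  field_simp
  ring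

/-- The substitution `ρ = s / r` on the positive half-line. -/
lemma lintegral_Ioi_comp_const_div {s : ℝ} (hs : 0 < s) (φ : ℝ → ENNReal) :
    ∫⁻ ρ in Set.Ioi (0 : ℝ), φ ρ =
      ∫⁻ r in Set.Ioi (0 : ℝ), ENNReal.ofReal (s / r ^ 2) * φ (s / r) := by
  have himg : (fun r : ℝ => s / r) '' Set.Ioi 0 = Set.Ioi 0 := by
    ext x
    constructor
    · rintro ⟨r, hr, rfl⟩
      exact div_pos hs hr
    · intro hx
      exact ⟨s / x, div_pos hs hx, by field_simp⟩
  have hderiv : ∀ x ∈ Set.Ioi (0 : ℝ),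
      HasDerivWithinAt (fun r : ℝ => s / r) (-(s / x ^ 2)) (Set.Ioi 0) x := by
    intro x hx
    have hx' : x ≠ 0 := ne_of_gt hx
    have := ((hasDerivAt_inv hx').const_mul s).hasDerivWithinAt (s := Set.Ioi (0 : ℝ))
    simpa [div_eq_mul_inv] using this
  have hinj : Set.InjOn (fun r : ℝ => s / r) (Set.Ioi 0) := by
    intro a ha b hb hab
    have ha' : a ≠ 0 := ne_of_gt ha
    have hb' : b ≠ 0 := ne_of_gt hb
    dsimp only at hab
    field_simp at hab
    exact hab.symm
  conv_lhs => rw [← himg]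
  rw [lintegral_image_eq_lintegral_abs_deriv_mul measurableSet_Ioi hderiv hinj]
  refine setLIntegral_congr_fun measurableSet_Ioi fun x _ => ?_
  rw [abs_neg, abs_of_nonneg (by positivity)]

/-- The radial law of the density is the law of `s / ‖w‖` for a standard Gaussian vector `w`. -/
lemma map_norm_withDensity_radialDensity {d n : ℕ} (hd : 0 < d) (hn : 0 < n) {s : ℝ}
    (hs : 0 < s) :
    ((volume : Measure (EuclideanSpace ℝ (Fin d))).withDensity
        fun y => ENNReal.ofReal (radialDensity d n s ‖y‖)).map norm =
      (stdGaussian (EuclideanSpace ℝ (Fin n))).map fun w => s / ‖w‖ := by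
  have : Nonempty (Fin d) := ⟨⟨0, hd⟩⟩
  have : Nonempty (Fin n) := ⟨⟨0, hn⟩⟩
  have hmeas := measurable_radialDensity d n s
  ext A hA
  rw [← lintegral_indicator_one hA, ← lintegral_indicator_one hA]
  have hψ : Measurable (A.indicator (1 : ℝ → ENNReal)) := measurable_one.indicator hA
  generalize A.indicator (1 : ℝ → ENNReal) = ψ at hψ
  rw [lintegral_map hψ (by fun_prop), lintegral_map hψ (by fun_prop), stdGaussian_eq_withDensity,
    lintegral_withDensity_eq_lintegral_mul _ (by fun_prop) (by fun_prop),
    lintegral_withDensity_eq_lintegral_mul _ (by fun_prop) (by fun_prop)]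
  simp only [Pi.mul_apply]
  rw [lintegral_comp_norm (E := EuclideanSpace ℝ (Fin d))
      (φ := fun r => ENNReal.ofReal (radialDensity d n s r) * ψ r) (by fun_prop),
    lintegral_comp_norm (E := EuclideanSpace ℝ (Fin n)) (φ := fun r => ENNReal.ofReal
      ((2 * Real.pi) ^ (-(Module.finrank ℝ (EuclideanSpace ℝ (Fin n)) : ℝ) / 2) *
        Real.exp (-r ^ 2 / 2)) * ψ (s / r)) (by fun_prop),
    finrank_mul_volume_ball hd, finrank_mul_volume_ball hn]
  conv_rhs => rw [lintegral_Ioi_comp_const_div hs]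
  rw [← lintegral_const_mul _ (by fun_prop), ← lintegral_const_mul _ (by fun_prop)]
  refine setLIntegral_congr_fun measurableSet_Ioi fun r hr => ?_
  have hr : 0 < r := hr
  have hGd : 0 < Real.Gamma ((d : ℝ) / 2) := Real.Gamma_pos_of_pos (by positivity)
  have hGn : 0 < Real.Gamma ((n : ℝ) / 2) := Real.Gamma_pos_of_pos (by positivity)
  simp only [finrank_euclideanSpace, Fintype.card_fin, div_div_cancel₀ hs.ne']
  simp only [← mul_assoc]
  congr 1
  simp only [mul_assoc]
  rw [← ENNReal.ofReal_mul (by positivity), ← ENNReal.ofReal_mul (by positivity),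
    sphere_mul_radialDensity hd hn hs hr, ENNReal.ofReal_mul (by positivity),
    ENNReal.ofReal_mul (by positivity), ENNReal.ofReal_mul (by positivity)]

end RadialDensity

section MinNormSolution

/-- The vector in the span of the family `b` whose inner products with `b` are prescribed by
`z`. -/
noncomputable def minNormSol {ι E : Type*} [Fintype ι] [DecidableEq ι] [NormedAddCommGroup E]
    [InnerProductSpace ℝ E] (z : ι → ℝ) (b : ι → E) : E :=
  ∑ i, ((gram ℝ b)⁻¹ *ᵥ z) i • b i

lemma continuous_gram {ι E : Type*} [NormedAddCommGroup E] [InnerProductSpace ℝ E] :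
    Continuous fun b : ι → E => gram ℝ b := by
  refine continuous_matrix fun i j => ?_
  simp only [gram_apply]
  fun_prop

lemma lintegral_pi_fin_succ {E : Type*} [MeasurableSpace E] {k : ℕ}
    (μ : Measure E) [SigmaFinite μ]
    {F : (Fin (k + 1) → E) → ENNReal} (hF : Measurable F) :
    ∫⁻ b, F b ∂(Measure.pi fun _ => μ) =
      ∫⁻ b : Fin k → E, ∫⁻ x, F (Fin.cons x b) ∂μ ∂(Measure.pi fun _ => μ) := by
  rw [← (measurePreserving_piFinSuccAbove (fun _ : Fin (k + 1) => μ) 0).symm.lintegral_comp hF,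
    lintegral_prod_symm' _ (by fun_prop)]
  simp [MeasurableEquiv.piFinSuccAbove, Fin.insertNthEquiv]

section Algebraic

variable {ι E : Type*} [Fintype ι] [DecidableEq ι] [NormedAddCommGroup E] [InnerProductSpace ℝ E]

lemma isUnit_det_gram {b : ι → E} (hb : LinearIndependent ℝ b) : IsUnit (gram ℝ b).det :=
  (posDef_gram_of_linearIndependent hb).det_pos.ne'.isUnit

lemma linearIndependent_iff_det_gram_ne_zero {b : ι → E} :
    LinearIndependent ℝ b ↔ (gram ℝ b).det ≠ 0 :=
  ⟨fun hb => (isUnit_det_gram hb).ne_zero, linearIndependent_of_det_gram_ne_zero⟩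

lemma inner_minNormSol {b : ι → E} (hb : LinearIndependent ℝ b) (z : ι → ℝ) (i : ι) :
    inner ℝ (b i) (minNormSol z b) = z i := by
  have h : (gram ℝ b *ᵥ ((gram ℝ b)⁻¹ *ᵥ z)) i = z i := by
    rw [mulVec_mulVec, mul_nonsing_inv _ (isUnit_det_gram hb), one_mulVec]
  rw [← h, minNormSol, inner_sum, mulVec, dotProduct]
  refine Finset.sum_congr rfl fun j _ => ?_
  rw [real_inner_smul_right, gram_apply, mul_comm]

lemma minNormSol_map (f : E ≃ₗᵢ[ℝ] E) (z : ι → ℝ) (b : ι → E) :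
    minNormSol z (fun i => f (b i)) = f (minNormSol z b) := by
  have : gram ℝ (fun i => f (b i)) = gram ℝ b := by
    ext i j
    simp
  simp [minNormSol, this, map_sum]

lemma minNormSol_mulVec {A : Matrix ι ι ℝ} (hA : Aᵀ * A = 1) (z : ι → ℝ) (b : ι → E) :
    minNormSol (A *ᵥ z) (fun i => ∑ j, A i j • b j) = minNormSol z b := by
  have hA' : A * Aᵀ = 1 := mul_eq_one_comm.mp hA
  have hgram : gram ℝ (fun i => ∑ j, A i j • b j) = A * gram ℝ b * Aᵀ := by
    ext i j
    simp only [gram_apply, sum_inner, inner_sum, mul_apply, transpose_apply, Finset.sum_mul,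
      real_inner_smul_left, real_inner_smul_right]
    refine Finset.sum_congr rfl fun _ _ => Finset.sum_congr rfl fun _ _ => by ring
  have hinv : (gram ℝ (fun i => ∑ j, A i j • b j))⁻¹ *ᵥ (A *ᵥ z) =
      A *ᵥ ((gram ℝ b)⁻¹ *ᵥ z) := by
    rw [hgram, Matrix.mul_inv_rev, Matrix.mul_inv_rev, inv_eq_left_inv hA, inv_eq_left_inv hA', mulVec_mulVec,
      mulVec_mulVec, Matrix.mul_assoc, Matrix.mul_assoc, hA, Matrix.mul_one]
  rw [minNormSol, hinv, minNormSol]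
  simp_rw [Finset.smul_sum]
  rw [Finset.sum_comm]
  refine Finset.sum_congr rfl fun j _ => ?_
  simp_rw [smul_smul, ← Finset.sum_smul]
  congr 1
  calc ∑ i, (A *ᵥ ((gram ℝ b)⁻¹ *ᵥ z)) i * A i j
      = (Aᵀ *ᵥ (A *ᵥ ((gram ℝ b)⁻¹ *ᵥ z))) j := by
        simp [mulVec, dotProduct, mul_comm]
    _ = _ := by rw [mulVec_mulVec, hA, one_mulVec]

/-- Any two vectors of the same Euclidean norm are related by an orthogonal matrix. -/
lemma exists_orthogonal_mulVec_eq {z w : ι → ℝ} (h : ∑ i, z i ^ 2 = ∑ i, w i ^ 2) :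
    ∃ A : Matrix ι ι ℝ, Aᵀ * A = 1 ∧ A *ᵥ z = w := by
  have hnorm : ‖WithLp.toLp 2 z‖ = ‖WithLp.toLp 2 w‖ := by
    simp [EuclideanSpace.norm_eq, h]
  obtain ⟨f, hf⟩ := exists_linearIsometryEquiv_apply_eq hnorm
  refine ⟨.of fun i j => f (EuclideanSpace.single j 1) i, ?_, ?_⟩
  · ext j k
    have := f.inner_map_map (EuclideanSpace.single j (1 : ℝ)) (EuclideanSpace.single k 1)
    rw [PiLp.inner_apply, EuclideanSpace.inner_single_left] at this
    simp only [mul_apply, transpose_apply, of_apply, one_apply]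
    simpa [mul_comm, Pi.single_apply, eq_comm] using this
  · have hz : WithLp.toLp 2 z = ∑ j, z j • EuclideanSpace.single j (1 : ℝ) := by
      ext i
      simp [Pi.single_apply]
    rw [hz, map_sum] at hf
    ext i
    have := congrArg (fun v : EuclideanSpace ℝ ι => v i) hf
    simpa [mulVec, dotProduct, mul_comm] using this

/-- The norm of the solution, when only one prescribed inner product is nonzero. -/
lemma norm_minNormSol_single {k : ℕ} {b : Fin k → E} {x : E} [FiniteDimensional ℝ E]
    (hb : LinearIndependent ℝ (Fin.cons x b : Fin (k + 1) → E)) {s : ℝ} (hs : 0 < s) :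
    ‖minNormSol (Pi.single 0 s) (Fin.cons x b : Fin (k + 1) → E)‖ =
      s / ‖(Submodule.span ℝ (Set.range b))ᗮ.orthogonalProjectionOnto x‖ := by
  set y := minNormSol (Pi.single 0 s) (Fin.cons x b : Fin (k + 1) → E) with hy
  set V := (Submodule.span ℝ (Set.range b))ᗮ with hV
  have hinner := inner_minNormSol hb (Pi.single 0 s)
  rw [← hy] at hinner
  have hx : inner ℝ x y = s := by simpa using hinner 0
  have hyb : ∀ i, inner ℝ (b i) y = 0 := fun i => by simpa using hinner i.succ
  have hyV : y ∈ V := by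
    rw [hV, Submodule.mem_orthogonal]
    intro u hu
    induction hu using Submodule.span_induction with
    | mem u hu => obtain ⟨i, rfl⟩ := hu; exact hyb i
    | zero => simp
    | add u v _ _ hu hv => rw [inner_add_left, hu, hv, add_zero]
    | smul c u _ hu => rw [real_inner_smul_left, hu, mul_zero]
  obtain ⟨c, hc⟩ : ∃ c : ℝ, y = c • (V.orthogonalProjectionOnto x : E) := by
    have hPb : ∀ i, V.orthogonalProjectionOnto (b i) = 0 := fun i => by
      rw [Submodule.orthogonalProjectionOnto_eq_zero_iff, hV]
      exact Submodule.le_orthogonal_orthogonal _ (Submodule.subset_span ⟨i, rfl⟩)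
    have h1 : (V.orthogonalProjectionOnto y : E) = y :=
      Submodule.starProjection_eq_self_iff.mpr hyV
    refine ⟨((gram ℝ (Fin.cons x b : Fin (k + 1) → E))⁻¹ *ᵥ Pi.single 0 s) 0, ?_⟩
    conv_lhs => rw [← h1, hy, minNormSol]
    rw [Fin.sum_univ_succ]
    simp [hPb]
  have hxP : inner ℝ x (V.orthogonalProjectionOnto x : E) =
      ‖V.orthogonalProjectionOnto x‖ ^ 2 := by
    rw [← real_inner_self_eq_norm_sq, real_inner_comm]
    exact (Submodule.inner_orthogonalProjectionOnto_eq_of_mem_left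
      (V.orthogonalProjectionOnto x) x).symm
  have hcs : c * ‖V.orthogonalProjectionOnto x‖ ^ 2 = s := by
    rw [← hxP, ← real_inner_smul_right, ← hc, hx]
  have hc0 : 0 < c := by
    by_contra hneg
    nlinarith [sq_nonneg ‖V.orthogonalProjectionOnto x‖]
  have hP : ‖V.orthogonalProjectionOnto x‖ ≠ 0 := fun h0 => by
    rw [h0] at hcs; norm_num at hcs; exact hs.ne hcs
  rw [hc, norm_smul, Real.norm_of_nonneg hc0.le, Submodule.coe_norm, ← hcs,
    ← Submodule.coe_norm]
  field_simp

end Algebraic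

section Gaussian

variable {ι E : Type*} [Fintype ι] [NormedAddCommGroup E] [InnerProductSpace ℝ E]
  [FiniteDimensional ℝ E] [MeasurableSpace E] [BorelSpace E]

lemma measurable_minNormSol [DecidableEq ι] (z : ι → ℝ) :
    Measurable (minNormSol z : (ι → E) → E) := by
  have hinv : ∀ i j, Measurable fun b : ι → E => (gram ℝ b)⁻¹ i j := by
    intro i j
    have h1 : Measurable fun b : ι → E => (gram ℝ b).det :=
      continuous_gram.matrix_det.measurable
    have h2 : Measurable fun b : ι → E => (gram ℝ b).adjugate i j :=
      (continuous_gram.matrix_adjugate.matrix_elem i j).measurable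
    simp only [Matrix.inv_def, Ring.inverse_eq_inv', Matrix.smul_apply, smul_eq_mul]
    exact h1.inv.mul h2
  unfold minNormSol
  simp only [mulVec, dotProduct]
  exact Finset.measurable_sum _ fun i _ => (Finset.measurable_sum _ fun j _ =>
    (hinv i j).mul_const _).smul (measurable_pi_apply i)

lemma map_pi_stdGaussian_linearIsometryEquiv (f : E ≃ₗᵢ[ℝ] E) :
    (Measure.pi fun _ : ι => stdGaussian E).map (fun b i => f (b i)) =
      Measure.pi fun _ : ι => stdGaussian E := by
  have (_ : ι) : SigmaFinite ((stdGaussian E).map f) := by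
    rw [stdGaussian_map]
    infer_instance
  rw [Measure.pi_map_pi (f := fun (_ : ι) (x : E) => f x) (fun _ => by fun_prop)]
  simp_rw [stdGaussian_map]

lemma map_pi_stdGaussian_orthogonal [DecidableEq ι] {A : Matrix ι ι ℝ} (hA : A * Aᵀ = 1) :
    (Measure.pi fun _ : ι => stdGaussian E).map (fun b i => ∑ j, A i j • b j) =
      Measure.pi fun _ : ι => stdGaussian E := by
  refine (MeasurableEquiv.toLp 2 (ι → E)).map_measurableEquiv_injective
    (Measure.ext_of_charFun (funext fun t => ?_))
  have hm1 : Measurable (WithLp.toLp 2 : (ι → E) → PiLp 2 fun _ : ι => E) :=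
    (MeasurableEquiv.toLp 2 (ι → E)).measurable
  have hm2 : Measurable fun (b : ι → E) (i : ι) => ∑ j, A i j • b j :=
    measurable_pi_lambda _ fun i => Finset.measurable_sum _ fun j _ =>
      (measurable_pi_apply j).const_smul (A i j)
  rw [MeasurableEquiv.coe_toLp, Measure.map_map hm1 hm2, charFun_pi]
  have h1 : charFun ((Measure.pi fun _ : ι => stdGaussian E).map
      (WithLp.toLp 2 ∘ fun b i => ∑ j, A i j • b j)) t =
      charFun ((Measure.pi fun _ : ι => stdGaussian E).map (WithLp.toLp 2))
        (WithLp.toLp 2 fun j => ∑ i, A i j • t i) := by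
    rw [charFun_apply, charFun_apply, integral_map (hm1.comp hm2).aemeasurable (by fun_prop),
      integral_map hm1.aemeasurable (by fun_prop)]
    refine integral_congr_ae (.of_forall fun b => ?_)
    simp only [PiLp.inner_apply, Function.comp_apply, sum_inner, inner_sum, real_inner_smul_left,
      real_inner_smul_right]
    rw [Finset.sum_comm]
  rw [h1, charFun_pi]
  simp_rw [charFun_stdGaussian, ← Complex.exp_sum]
  congr 1
  rw [← Finset.sum_div, ← Finset.sum_div, Finset.sum_neg_distrib, Finset.sum_neg_distrib]
  congr 2
  norm_cast
  simp_rw [← real_inner_self_eq_norm_sq, sum_inner, inner_sum, real_inner_smul_left,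
    real_inner_smul_right]
  rw [Finset.sum_comm]
  refine Finset.sum_congr rfl fun i _ => ?_
  rw [Finset.sum_comm]
  have hAi : ∀ j, ∑ k, A i k * A j k = if i = j then 1 else 0 := fun j => by
    have := congrFun (congrFun hA i) j
    simpa [mul_apply, one_apply] using this
  simp_rw [← mul_assoc, ← Finset.sum_mul, hAi]
  simp

lemma measurableSet_linearIndependent :
    MeasurableSet {b : ι → E | LinearIndependent ℝ b} := by
  classical
  simp_rw [linearIndependent_iff_det_gram_ne_zero]
  have h : Measurable fun b : ι → E => (gram ℝ b).det := continuous_gram.matrix_det.measurable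
  exact (h (measurableSet_singleton 0)).compl

lemma ae_linearIndependent_cons {k : ℕ} (hk : k < Module.finrank ℝ E) {b : Fin k → E}
    (hb : LinearIndependent ℝ b) :
    ∀ᵐ x ∂(stdGaussian E), LinearIndependent ℝ (Fin.cons x b : Fin (k + 1) → E) := by
  have hspan : Submodule.span ℝ (Set.range b) ≠ ⊤ := fun h => by
    have := finrank_span_eq_card hb
    rw [h, finrank_top, Fintype.card_fin] at this
    exact hk.ne' this
  filter_upwards [ae_stdGaussian_notMem hspan] with x hx
  exact linearIndependent_finCons.mpr ⟨hb, hx⟩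

lemma ae_linearIndependent_pi_stdGaussian {k : ℕ} (hk : k ≤ Module.finrank ℝ E) :
    ∀ᵐ b ∂(Measure.pi fun _ : Fin k => stdGaussian E), LinearIndependent ℝ b := by
  induction k with
  | zero => exact .of_forall fun b => linearIndependent_empty_type
  | succ k ih =>
    have hms := (measurableSet_linearIndependent (ι := Fin (k + 1)) (E := E)).compl
    change (Measure.pi fun _ => stdGaussian E) {b | LinearIndependent ℝ b}ᶜ = 0
    rw [← lintegral_indicator_one hms,
      lintegral_pi_fin_succ _ (measurable_one.indicator hms)]
    refine lintegral_eq_zero_of_ae_eq_zero ?_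
    filter_upwards [ih (by omega)] with b hb
    refine lintegral_eq_zero_of_ae_eq_zero ?_
    filter_upwards [ae_linearIndependent_cons hk hb] with x hx
    exact Set.indicator_of_notMem (Set.notMem_compl_iff.mpr hx) _

lemma map_orthogonalProjectionOnto_stdGaussian (V : Submodule ℝ E) :
    (stdGaussian E).map V.orthogonalProjectionOnto = stdGaussian V := by
  apply Measure.ext_of_charFun
  ext t
  rw [charFun_stdGaussian, charFun_apply, integral_map (by fun_prop) (by fun_prop),
    Submodule.coe_norm, ← charFun_stdGaussian, charFun_apply]
  refine integral_congr_ae (.of_forall fun x => ?_)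
  simp

lemma lintegral_comp_norm_stdGaussian {F : Type*} [NormedAddCommGroup F] [InnerProductSpace ℝ F]
    [FiniteDimensional ℝ F] [MeasurableSpace F] [BorelSpace F]
    (h : Module.finrank ℝ E = Module.finrank ℝ F) {φ : ℝ → ENNReal} (hφ : Measurable φ) :
    ∫⁻ x, φ ‖x‖ ∂(stdGaussian E) = ∫⁻ x, φ ‖x‖ ∂(stdGaussian F) := by
  let f : E ≃ₗᵢ[ℝ] F :=
    (stdOrthonormalBasis ℝ E).equiv (stdOrthonormalBasis ℝ F) (finCongr h)
  rw [← stdGaussian_map f, lintegral_map (by fun_prop) (by fun_prop)]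
  simp

/-- The law of the norm of the minimal norm solution of a Gaussian system whose right-hand side
is supported on one coordinate. -/
lemma map_norm_minNormSol_single {k : ℕ} (hk : k < Module.finrank ℝ E) {s : ℝ} (hs : 0 < s) :
    (Measure.pi fun _ : Fin (k + 1) => stdGaussian E).map
        (fun b => ‖minNormSol (Pi.single 0 s) b‖) =
      (stdGaussian (EuclideanSpace ℝ (Fin (Module.finrank ℝ E - k)))).map
        fun w => s / ‖w‖ := by
  have hm : Measurable (minNormSol (Pi.single 0 s) : (Fin (k + 1) → E) → E) :=
    measurable_minNormSol _
  ext A hA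
  rw [← lintegral_indicator_one hA, ← lintegral_indicator_one hA]
  have hψ : Measurable (A.indicator (1 : ℝ → ENNReal)) := measurable_one.indicator hA
  generalize A.indicator (1 : ℝ → ENNReal) = ψ at hψ
  rw [lintegral_map hψ (by fun_prop), lintegral_map hψ (by fun_prop),
    lintegral_pi_fin_succ _ (by fun_prop)]
  have hinner : ∀ᵐ b ∂(Measure.pi fun _ : Fin k => stdGaussian E),
      ∫⁻ x, ψ ‖minNormSol (Pi.single 0 s) (Fin.cons x b : Fin (k + 1) → E)‖ ∂(stdGaussian E) =
        ∫⁻ w, ψ (s / ‖w‖) ∂(stdGaussian (EuclideanSpace ℝ (Fin (Module.finrank ℝ E - k)))) := by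
    filter_upwards [ae_linearIndependent_pi_stdGaussian hk.le] with b hb
    have hdim : Module.finrank ℝ (Submodule.span ℝ (Set.range b))ᗮ =
        Module.finrank ℝ (EuclideanSpace ℝ (Fin (Module.finrank ℝ E - k))) := by
      have h1 := Submodule.finrank_add_finrank_orthogonal (Submodule.span ℝ (Set.range b))
      rw [finrank_span_eq_card hb, Fintype.card_fin] at h1
      rw [finrank_euclideanSpace, Fintype.card_fin]
      omega
    rw [← lintegral_comp_norm_stdGaussian hdim (φ := fun r => ψ (s / r)) (by fun_prop),
      ← map_orthogonalProjectionOnto_stdGaussian, lintegral_map (by fun_prop) (by fun_prop)]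
    refine lintegral_congr_ae ?_
    filter_upwards [ae_linearIndependent_cons hk hb] with x hx
    rw [norm_minNormSol_single hx hs]
  rw [lintegral_congr_ae hinner]
  simp

end Gaussian

end MinNormSolution

section GaussianMatrix

lemma map_toLp_gaussMatrix (D d : ℕ) :
    (gaussMatrix D d).map (fun B i => WithLp.toLp 2 (B i)) =
      Measure.pi fun _ : Fin D => stdGaussian (EuclideanSpace ℝ (Fin d)) := by
  have (_ : Fin D) : SigmaFinite ((Measure.pi fun _ : Fin d => gaussianReal 0 1).map
      (WithLp.toLp 2)) := by
    rw [map_pi_eq_stdGaussian]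
    infer_instance
  rw [gaussMatrix, Measure.pi_map_pi (f := fun (_ : Fin D) (x : Fin d → ℝ) => WithLp.toLp 2 x)
    (fun _ => (MeasurableEquiv.toLp 2 (Fin d → ℝ)).measurable.aemeasurable)]
  simp_rw [map_pi_eq_stdGaussian]

/-- The law of the minimal norm solution of a Gaussian system. -/
lemma map_minNormSol_pi_stdGaussian {k d : ℕ} (hk : k < d) {z : Fin (k + 1) → ℝ} (hz : z ≠ 0) :
    (Measure.pi fun _ : Fin (k + 1) => stdGaussian (EuclideanSpace ℝ (Fin d))).map
        (minNormSol z) =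
      volume.withDensity fun y : EuclideanSpace ℝ (Fin d) =>
        ENNReal.ofReal (radialDensity d (d - k) (√(∑ i, z i ^ 2)) ‖y‖) := by
  have hd : 0 < d := by omega
  have : Nonempty (Fin d) := ⟨⟨0, hd⟩⟩
  have hm (w : Fin (k + 1) → ℝ) :
      Measurable (minNormSol w : (Fin (k + 1) → EuclideanSpace ℝ (Fin d)) → _) :=
    measurable_minNormSol w
  have hpos : 0 < ∑ i, z i ^ 2 := by
    obtain ⟨i, hi⟩ := Function.ne_iff.mp hz
    exact Finset.sum_pos' (fun j _ => sq_nonneg _)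
      ⟨i, Finset.mem_univ i, by have hi0 : z i ≠ 0 := hi; positivity⟩
  set s := √(∑ i, z i ^ 2) with hs_def
  have hs : 0 < s := Real.sqrt_pos.mpr hpos
  obtain ⟨A, hA, hAz⟩ := exists_orthogonal_mulVec_eq (z := z) (w := Pi.single 0 s) (by
    rw [Finset.sum_eq_single (0 : Fin (k + 1)) (f := fun i => (Pi.single 0 s : _ → ℝ) i ^ 2)
      (fun i _ hi => by simp [hi]) (by simp), Pi.single_eq_same, hs_def, Real.sq_sqrt hpos.le])
  have hnorm : ((Measure.pi fun _ : Fin (k + 1) => stdGaussian (EuclideanSpace ℝ (Fin d))).map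
      (minNormSol z)).map norm = (volume.withDensity fun y : EuclideanSpace ℝ (Fin d) =>
        ENNReal.ofReal (radialDensity d (d - k) s ‖y‖)).map norm := by
    rw [map_norm_withDensity_radialDensity hd (by omega) hs, Measure.map_map measurable_norm (hm z)]
    have h1 := map_norm_minNormSol_single (E := EuclideanSpace ℝ (Fin d)) (k := k)
      (by simpa using hk) hs
    have hmA : Measurable fun (b : Fin (k + 1) → EuclideanSpace ℝ (Fin d)) i =>
        ∑ j, A i j • b j :=
      measurable_pi_lambda _ fun i => Finset.measurable_sum _ fun j _ =>
        (measurable_pi_apply j).const_smul (A i j)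
    rw [finrank_euclideanSpace, Fintype.card_fin,
      ← map_pi_stdGaussian_orthogonal (mul_eq_one_comm.mp hA),
      Measure.map_map (hm _).norm hmA] at h1
    rw [← h1, ← hAz]
    congr 1
    ext b
    simp only [Function.comp_apply, minNormSol_mulVec hA]
  have : IsProbabilityMeasure
      ((Measure.pi fun _ : Fin (k + 1) => stdGaussian (EuclideanSpace ℝ (Fin d))).map
        (minNormSol z)) := Measure.isProbabilityMeasure_map (hm z).aemeasurable
  have : IsFiniteMeasure (volume.withDensity fun y : EuclideanSpace ℝ (Fin d) =>
      ENNReal.ofReal (radialDensity d (d - k) s ‖y‖)) := by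
    constructor
    have h2 := congrArg (fun μ : Measure ℝ => μ Set.univ) hnorm
    simp only [Measure.map_apply measurable_norm MeasurableSet.univ, Set.preimage_univ,
      measure_univ] at h2
    rw [← h2]
    exact ENNReal.one_lt_top
  refine ext_of_map_norm_eq (fun f => ?_) (fun f => ?_) hnorm
  · conv_rhs => rw [← map_pi_stdGaussian_linearIsometryEquiv f]
    rw [Measure.map_map (by fun_prop) (hm z), Measure.map_map (hm z) (by fun_prop)]
    congr 1
    ext1 b
    exact (minNormSol_map f z b).symm
  · exact map_withDensity_norm_linearIsometryEquiv
      (φ := fun r => ENNReal.ofReal (radialDensity d (d - k) s r))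
      (measurable_radialDensity _ _ _).ennreal_ofReal f

lemma gram_toLp {D d : ℕ} (B : Fin D → Fin d → ℝ) :
    gram ℝ (fun i => WithLp.toLp 2 (B i)) = of B * (of B)ᵀ := by
  ext i j
  simp [mul_apply, PiLp.inner_apply, mul_comm]

lemma minNormSol_toLp {D d : ℕ} (z : Fin D → ℝ) (B : Fin D → Fin d → ℝ) :
    (minNormSol z fun i => WithLp.toLp 2 (B i)).ofLp =
      ((of B)ᵀ * (of B * (of B)ᵀ)⁻¹) *ᵥ z := by
  ext j
  rw [← mulVec_mulVec, ← gram_toLp]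
  simp [minNormSol, mulVec, dotProduct, mul_comm]

end GaussianMatrix

theorem stmt14 (de d : ℕ) (hde : 0 < de) (hd : 0 < d) (h : de ≤ d)
    (n : ℕ) (hn : n = d - de + 1)
    (z : Fin de → ℝ) (hz : z ≠ 0)
    (y2 : (Fin de → Fin d → ℝ) → (Fin d → ℝ))
    (hy2 : ∀ B : Fin de → Fin d → ℝ,
      IsUnit (Matrix.of B * (Matrix.of B).transpose) →
      y2 B = ((Matrix.of B).transpose *
        (Matrix.of B * (Matrix.of B).transpose)⁻¹).mulVec z) :
    Measure.map y2 (gaussMatrix de d)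
      = volume.withDensity (fun y : Fin d → ℝ => ENNReal.ofReal (
          Real.pi ^ (-(d : ℝ) / 2) *
          (Real.Gamma ((d : ℝ) / 2) / Real.Gamma ((n : ℝ) / 2)) *
          (Real.sqrt (∑ i, z i ^ 2) / Real.sqrt 2) ^ n *
          (∑ i, y i ^ 2) ^ (-(((n : ℝ) + (d : ℝ)) / 2)) *
          Real.exp (-(∑ i, z i ^ 2) / (2 * ∑ i, y i ^ 2)))) := by
  obtain ⟨k, rfl⟩ : ∃ k, de = k + 1 := ⟨de - 1, by omega⟩
  obtain rfl : n = d - k := by omega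
  have hT : Measurable fun (B : Fin (k + 1) → Fin d → ℝ) i => WithLp.toLp 2 (B i) :=
    measurable_pi_lambda _ fun i =>
      (MeasurableEquiv.toLp 2 (Fin d → ℝ)).measurable.comp (measurable_pi_apply i)
  have hY : Measurable
      (minNormSol z : (Fin (k + 1) → EuclideanSpace ℝ (Fin d)) → EuclideanSpace ℝ (Fin d)) :=
    measurable_minNormSol z
  have hofLp : MeasurePreserving (WithLp.ofLp : EuclideanSpace ℝ (Fin d) → Fin d → ℝ) :=
    PiLp.volume_preserving_ofLp (Fin d)
  have hae : y2 =ᵐ[gaussMatrix (k + 1) d]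
      WithLp.ofLp ∘ minNormSol z ∘ fun B i => WithLp.toLp 2 (B i) := by
    have hli : ∀ᵐ b ∂((gaussMatrix (k + 1) d).map fun B i => WithLp.toLp 2 (B i)),
        LinearIndependent ℝ b := by
      rw [map_toLp_gaussMatrix]
      exact ae_linearIndependent_pi_stdGaussian (by simpa using h)
    filter_upwards [ae_of_ae_map hT.aemeasurable hli] with B hB
    rw [hy2 B ((isUnit_iff_isUnit_det _).mpr (gram_toLp B ▸ isUnit_det_gram hB))]
    exact (minNormSol_toLp z B).symm
  rw [Measure.map_congr hae, ← Measure.map_map hofLp.measurable (hY.comp hT),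
    ← Measure.map_map hY hT, map_toLp_gaussMatrix, map_minNormSol_pi_stdGaussian (by omega) hz]
  ext A hA
  rw [Measure.map_apply hofLp.measurable hA, withDensity_apply _ (hofLp.measurable hA),
    withDensity_apply _ hA, ← hofLp.setLIntegral_comp_preimage hA (by fun_prop)]
  refine lintegral_congr fun y => ?_
  rw [radialDensity, EuclideanSpace.real_norm_sq_eq,
    Real.sq_sqrt (Finset.sum_nonneg fun i _ => sq_nonneg _)]
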